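/- For the double-sequence SDP with parameter m ≥ 2 and any 2 ≤ i ≤ m: a positive semidefinite n×n matrix Y (n = 2m+1) satisfies trace(BY) = 0 and trace(AⱼY) = 0 for j = 2,…,i if and only if its first m+i rows and columns are zero; that is, PSD^n ∩ B^⊥ ∩ A₂^⊥ ∩ … ∩ A_i^⊥ = 0_{m+i} ⊕ PSD^{m−i+1}. -/

import Mathlib

open Matrix

/-- `Eij n i j` : the `n×n` symmetric matrix whose only nonzero entries are `1`
in positions `(i,j)` and `(j,i)` (0-based indices). -/
def Eij (n i j : ℕ) : Matrix (Fin n) (Fin n) ℝ :=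
  Matrix.of fun a b => if (a.val = i ∧ b.val = j) ∨ (a.val = j ∧ b.val = i) then 1 else 0

/-- The constraint matrices of the double-sequence SDP with parameter `m`
(`n = 2m+1`, 0-based index `k`): `A₁ = E₁ + E_{m+1}`,
`Aᵢ = Eᵢ + E_{m+i} + E_{i-1,n} + E_{m+i-1,n}` for `i = 2, …, m-1`, and
`A_m = E_m - E_{2m} + E_{m-1,n} + E_{2m-1,n}` (1-based indices of the paper). -/
def doubleA (m : ℕ) : Fin m → Matrix (Fin (2 * m + 1)) (Fin (2 * m + 1)) ℝ := fun k =>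
  if k.val = 0 then Eij (2 * m + 1) 0 0 + Eij (2 * m + 1) m m
  else if k.val = m - 1 then
    Eij (2 * m + 1) (m - 1) (m - 1) - Eij (2 * m + 1) (2 * m - 1) (2 * m - 1) +
      Eij (2 * m + 1) (m - 2) (2 * m) + Eij (2 * m + 1) (2 * m - 2) (2 * m)
  else
    Eij (2 * m + 1) k.val k.val + Eij (2 * m + 1) (m + k.val) (m + k.val) +
      Eij (2 * m + 1) (k.val - 1) (2 * m) + Eij (2 * m + 1) (m + k.val - 1) (2 * m)

/-- The right hand side of the double-sequence SDP: ones in the first `m+1`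
diagonal entries, zeros elsewhere. -/
def doubleB (m : ℕ) : Matrix (Fin (2 * m + 1)) (Fin (2 * m + 1)) ℝ :=
  Matrix.of fun a b => if a = b ∧ a.val < m + 1 then 1 else 0

theorem trace_Eij_self_mul {n : ℕ} (Y : Matrix (Fin n) (Fin n) ℝ) (p : Fin n) :
    (Eij n p p * Y).trace = Y p p := by
  have h : Eij n p p = Matrix.single p p 1 := by
    ext a b
    simp only [Eij, Matrix.of_apply, Matrix.single_apply, Fin.ext_iff]
    grind
  rw [h, Matrix.trace_single_mul]
  simp

theorem trace_Eij_mul_of_ne {n : ℕ} (Y : Matrix (Fin n) (Fin n) ℝ) {p q : Fin n} (hpq : p ≠ q) :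
    (Eij n p q * Y).trace = Y p q + Y q p := by
  have h : Eij n p q = Matrix.single p q 1 + Matrix.single q p 1 := by
    ext a b
    simp only [Eij, Matrix.of_apply, Matrix.add_apply, Matrix.single_apply]
    grind
  rw [h, add_mul, Matrix.trace_add, Matrix.trace_single_mul, Matrix.trace_single_mul]
  simp [add_comm]

theorem trace_doubleB_mul (m : ℕ) (Y : Matrix (Fin (2 * m + 1)) (Fin (2 * m + 1)) ℝ) :
    (doubleB m * Y).trace = ∑ a, if a.val < m + 1 then Y a a else 0 := by
  have h : doubleB m = Matrix.diagonal fun a => if a.val < m + 1 then 1 else 0 := by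
    ext a b
    simp only [doubleB, Matrix.of_apply, Matrix.diagonal_apply]
    grind
  simp [h, Matrix.trace]

theorem trace_doubleA_mul {m : ℕ} (Y : Matrix (Fin (2 * m + 1)) (Fin (2 * m + 1)) ℝ) (k : Fin m)
    {p q r s t : Fin (2 * m + 1)} (hk : 1 ≤ k.val) (hp : p.val = k) (hq : q.val = m + k)
    (hr : r.val = k - 1) (hs : s.val = m + k - 1) (ht : t.val = 2 * m) :
    ∃ c : ℝ, c ≠ 0 ∧ (doubleA m k * Y).trace =
      Y p p + c * Y q q + (Y r t + Y t r) + (Y s t + Y t s) := by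
  have hkm := k.isLt
  have hrt : r ≠ t := by rw [Ne, Fin.ext_iff]; omega
  have hst : s ≠ t := by rw [Ne, Fin.ext_iff]; omega
  rw [← trace_Eij_self_mul Y p, ← trace_Eij_self_mul Y q, ← trace_Eij_mul_of_ne Y hrt,
    ← trace_Eij_mul_of_ne Y hst]
  by_cases hkl : k.val = m - 1
  · refine ⟨-1, by norm_num, ?_⟩
    rw [doubleA, if_neg (by omega), if_pos hkl, hp, hq, hr, hs, ht,
      show m - 1 = k.val by omega, show 2 * m - 1 = m + k.val by omega,
      show m - 2 = k.val - 1 by omega, show 2 * m - 2 = m + k.val - 1 by omega]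
    simp only [add_mul, sub_mul, Matrix.trace_add, Matrix.trace_sub]
    ring
  · refine ⟨1, one_ne_zero, ?_⟩
    rw [doubleA, if_neg (by omega), if_neg hkl, hp, hq, hr, hs, ht]
    simp only [add_mul, Matrix.trace_add]
    ring

theorem Matrix.PosSemidef.row_col_eq_zero_of_diag_eq_zero {n : ℕ} {Y : Matrix (Fin n) (Fin n) ℝ}
    (hY : Y.PosSemidef) {a : Fin n} (ha : Y a a = 0) (b : Fin n) : Y a b = 0 ∧ Y b a = 0 := by
  have h : Y *ᵥ Pi.single a 1 = 0 := by
    rw [← hY.dotProduct_mulVec_zero_iff]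
    simp [ha]
  have hba : Y b a = 0 := by simpa using congrFun h b
  exact ⟨by simpa [hba] using (hY.isHermitian.apply a b).symm, hba⟩

/-- For the double-sequence SDP with parameter `m ≥ 2` and any `2 ≤ i ≤ m`:
a psd matrix `Y` satisfies `trace(B Y) = 0` and `trace(Aⱼ Y) = 0` for
`j = 2, …, i` iff its first `m+i` rows and columns are zero; i.e.
`PSDⁿ ∩ B^⊥ ∩ A₂^⊥ ∩ … ∩ A_i^⊥ = 0_{m+i} ⊕ PSD^{m-i+1}`. -/
theorem doubleSeq_homDual_zero_rows {m i : ℕ} (hm : 2 ≤ m) (h1 : 2 ≤ i) (h2 : i ≤ m)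
    (Y : Matrix (Fin (2 * m + 1)) (Fin (2 * m + 1)) ℝ) (hY : Y.PosSemidef) :
    (((doubleB m) * Y).trace = 0 ∧
      ∀ k : Fin m, 1 ≤ k.val → k.val < i → ((doubleA m k) * Y).trace = 0) ↔
    (∀ a b : Fin (2 * m + 1), a.val < m + i → Y a b = 0 ∧ Y b a = 0) := by
  constructor
  · rintro ⟨hB, hA⟩
    have hdiag : ∀ a : Fin (2 * m + 1), a.val < m + 1 → Y a a = 0 := by
      intro a ha
      rw [trace_doubleB_mul, Finset.sum_eq_zero_iff_of_nonneg] at hB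
      · simpa [ha] using hB a (Finset.mem_univ a)
      · intro b _
        split_ifs
        exacts [hY.diag_nonneg, le_rfl]
    have hrows : ∀ j : ℕ, ∀ a b : Fin (2 * m + 1), a.val = j → j < m + i →
        Y a b = 0 ∧ Y b a = 0 := by
      intro j
      induction j using Nat.strong_induction_on with
      | _ j ih =>
        intro a b haj hj
        refine hY.row_col_eq_zero_of_diag_eq_zero ?_ b
        by_cases hjm : j < m + 1
        · exact hdiag a (by omega)
        obtain ⟨k, rfl⟩ : ∃ k, j = m + k := ⟨j - m, by omega⟩
        obtain ⟨c, hc, h⟩ := trace_doubleA_mul Y ⟨k, by omega⟩ (p := ⟨k, by omega⟩) (q := a)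
          (r := ⟨k - 1, by omega⟩) (s := ⟨m + k - 1, by omega⟩) (t := ⟨2 * m, by omega⟩)
          (show 1 ≤ k by omega) rfl haj rfl rfl rfl
        rw [hA ⟨k, by omega⟩ (show 1 ≤ k by omega) (show k < i by omega)] at h
        have hr := ih (k - 1) (by omega) ⟨k - 1, by omega⟩ ⟨2 * m, by omega⟩ rfl (by omega)
        have hs := ih (m + k - 1) (by omega) ⟨m + k - 1, by omega⟩ ⟨2 * m, by omega⟩ rfl
          (by omega)
        rw [hdiag ⟨k, by omega⟩ (show k < m + 1 by omega), hr.1, hr.2, hs.1, hs.2] at h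
        simpa [hc] using h
    exact fun a b ha => hrows a a b rfl ha
  · intro h
    constructor
    · rw [trace_doubleB_mul]
      refine Finset.sum_eq_zero fun a _ => ?_
      split_ifs with ha
      exacts [(h a a (by omega)).1, rfl]
    · intro k hk hki
      obtain ⟨c, -, hc⟩ := trace_doubleA_mul Y k (p := ⟨k, by omega⟩) (q := ⟨m + k, by omega⟩)
        (r := ⟨k - 1, by omega⟩) (s := ⟨m + k - 1, by omega⟩) (t := ⟨2 * m, by omega⟩)
        hk rfl rfl rfl rfl rfl
      have hr := h ⟨k - 1, by omega⟩ ⟨2 * m, by omega⟩ (show k.val - 1 < m + i by omega)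
      have hs := h ⟨m + k - 1, by omega⟩ ⟨2 * m, by omega⟩ (show m + k.val - 1 < m + i by omega)
      rw [hc, (h ⟨k, by omega⟩ _ (show k.val < m + i by omega)).1,
        (h ⟨m + k, by omega⟩ _ (show m + k.val < m + i by omega)).1, hr.1, hr.2, hs.1, hs.2]
      simp
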